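/- Fix m ≥ 1, a, b_1,…,b_m, c_1,…,c_m ∈ ℂ, set β_{0,i} = b_i, β_{1,i} = c_i − 1 − b_i, and for v ∈ {0,1}^m set Σβ_v = Σ_{i=1}^m β_{v_i,i} and let σ_j·v be v with the j-th coordinate flipped. Then for every v ∈ {0,1}^m and all t, x ∈ ℂ^m with (1 − Σ_i t_i x_i)·∏_{i=1}^m t_i(t_i − 1) ≠ 0 one has a(1 − Σ_{i=1}^m v_i x_i)/((1 − Σ_i t_i x_i)·∏_{i=1}^m (t_i − v_i)) = (a − Σβ_v)/∏_{i=1}^m (t_i − v_i) − Σ_{j=1}^m β_{1−v_j,j}/∏_{i=1}^m (t_i − (σ_j·v)_i) + Σ_{j=1}^m ω_{T_j}(t,x)/∏_{1≤i≤m, i≠j}(t_i − v_i), where ω_{T_j}(t,x) = β_{0,j}/t_j + β_{1,j}/(t_j − 1) + a x_j/(1 − Σ_{i=1}^m t_i x_i). -/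

import Mathlib

open Finset

/-- `v_i ∈ {0,1}` regarded as a complex number. -/
def bval (s : Bool) : ℂ := if s then 1 else 0

/-- The parameters `β_{0,i} = b_i`, `β_{1,i} = c_i − 1 − b_i`. -/
def betaP {m : ℕ} (b c : Fin m → ℂ) (s : Bool) (i : Fin m) : ℂ :=
  if s then c i - 1 - b i else b i

/-- `ω_{T_j}(t,x) = β_{0,j}/t_j + β_{1,j}/(t_j − 1) + a x_j/(1 − Σ t_i x_i)`. -/
noncomputable def omegaT {m : ℕ} (a : ℂ) (b c : Fin m → ℂ) (t x : Fin m → ℂ) (j : Fin m) : ℂ :=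
  betaP b c false j / t j + betaP b c true j / (t j - 1) + a * x j / (1 - ∑ i, t i * x i)

/-- `σ_j·v` : flip the `j`-th coordinate of `v`. -/
def flipv {m : ℕ} (j : Fin m) (v : Fin m → Bool) : Fin m → Bool :=
  Function.update v j (!(v j))

theorem omegaT_mul_sub {m : ℕ} (a : ℂ) (b c : Fin m → ℂ) (s : Bool) (t x : Fin m → ℂ) (j : Fin m)
    (h0 : t j ≠ 0) (h1 : t j - 1 ≠ 0) :
    omegaT a b c t x j * (t j - bval s) =
      betaP b c s j + betaP b c (!s) j * (t j - bval s) / (t j - bval (!s))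
        + a * x j * (t j - bval s) / (1 - ∑ i, t i * x i) := by
  unfold omegaT
  rw [add_mul, div_mul_eq_mul_div (a * x j)]
  congr 1
  cases s <;> simp [bval] <;> field_simp
  ring

theorem prod_sub_bval_flipv {m : ℕ} (t : Fin m → ℂ) (v : Fin m → Bool) (j : Fin m) :
    ∏ i, (t i - bval (flipv j v i)) =
      (t j - bval (!(v j))) * ∏ i ∈ univ.erase j, (t i - bval (v i)) := by
  rw [← mul_prod_erase univ _ (mem_univ j)]
  congr 1
  · simp [flipv]
  · refine prod_congr rfl fun i hi => ?_
    simp [flipv, Function.update_of_ne (ne_of_mem_erase hi)]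

/-- **Proposition 3.3 (scalar form).** For every `v ∈ {0,1}^m` and all `t, x` with
`(1 − Σ t_i x_i)·∏ t_i(t_i − 1) ≠ 0`:
`a(1 − Σ v_i x_i)/((1 − Σ t_i x_i)·∏(t_i − v_i))
  = (a − Σβ_v)/∏(t_i − v_i) − Σ_j β_{1−v_j,j}/∏(t_i − (σ_j·v)_i)
    + Σ_j ω_{T_j}/∏_{i≠j}(t_i − v_i)`. -/
theorem stmt_2 (m : ℕ) (hm : 1 ≤ m) (a : ℂ) (b c : Fin m → ℂ)
    (v : Fin m → Bool) (t x : Fin m → ℂ)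
    (h : (1 - ∑ i, t i * x i) * ∏ i, (t i * (t i - 1)) ≠ 0) :
    a * (1 - ∑ i, bval (v i) * x i) /
        ((1 - ∑ i, t i * x i) * ∏ i, (t i - bval (v i))) =
      (a - ∑ i, betaP b c (v i) i) / ∏ i, (t i - bval (v i))
        - ∑ j, betaP b c (!(v j)) j / ∏ i, (t i - bval (flipv j v i))
        + ∑ j, omegaT a b c t x j / ∏ i ∈ univ.erase j, (t i - bval (v i)) := by
  obtain ⟨hD, hP⟩ := mul_ne_zero_iff.mp h
  have ht (i : Fin m) : t i ≠ 0 ∧ t i - 1 ≠ 0 :=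
    mul_ne_zero_iff.mp (prod_ne_zero_iff.mp hP i (mem_univ i))
  have hu (i : Fin m) (s : Bool) : t i - bval s ≠ 0 := by
    cases s
    · simpa [bval] using (ht i).1
    · simpa [bval] using (ht i).2
  have hprod : ∏ i, (t i - bval (v i)) ≠ 0 := prod_ne_zero_iff.mpr fun i _ => hu i (v i)
  have key (j : Fin m) :
      omegaT a b c t x j / ∏ i ∈ univ.erase j, (t i - bval (v i)) =
        betaP b c (!(v j)) j / ∏ i, (t i - bval (flipv j v i)) +
          (betaP b c (v j) j + a * (t j * x j - bval (v j) * x j) / (1 - ∑ i, t i * x i)) /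
            ∏ i, (t i - bval (v i)) := by
    have hE : ∏ i ∈ univ.erase j, (t i - bval (v i)) ≠ 0 :=
      prod_ne_zero_iff.mpr fun i _ => hu i (v i)
    have hj := hu j (v j)
    have hj' := hu j (!(v j))
    have hω := omegaT_mul_sub a b c (v j) t x j (ht j).1 (ht j).2
    rw [prod_sub_bval_flipv, ← mul_prod_erase univ (fun i => t i - bval (v i)) (mem_univ j),
      ← mul_div_mul_left _ _ hj, mul_comm _ (omegaT a b c t x j), hω]
    field_simp
    ring
  rw [sum_congr rfl fun j _ => key j, sum_add_distrib, ← sum_div, sum_add_distrib, ← sum_div,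
    ← mul_sum, sum_sub_distrib]
  field_simp
  ring
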